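/- arXiv:0812.4846 — 3 statements merged into one kernel-verified Lean document; each statement's English description precedes it below -/
import Mathlib

section
/- Fix δ₀ ≥ 0. For each δ₁ > 0 let g_{δ₁}(x) = (x + π²)δ₁ + ((x + π²)³ + π²(x + π²)δ₀)/x for x > 0, and let x_c : (0, ∞) → (0, ∞) be any function such that for every δ₁ > 0, x_c(δ₁) is a minimizer of g_{δ₁} on (0, ∞). Then δ₁ · x_c(δ₁)² tends to π⁴(π² + δ₀) as δ₁ → +∞. -/
open Real Filter

/-- Large-friction asymptotics of the critical wavenumber (equation (10.28)):
if for every `δ₁ > 0`, `x_c(δ₁) > 0` minimizes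
`g_{δ₁}(x) = (x + π²)δ₁ + ((x + π²)³ + π²(x + π²)δ₀)/x` over `(0, ∞)`, then
`δ₁ · x_c(δ₁)² → π⁴(π² + δ₀)` as `δ₁ → +∞`. -/
theorem critical_wavenumber_asymptotics (δ₀ : ℝ) (h₀ : 0 ≤ δ₀) (xc : ℝ → ℝ)
    (hxc : ∀ δ₁ : ℝ, 0 < δ₁ → 0 < xc δ₁ ∧ ∀ x : ℝ, 0 < x →
      (xc δ₁ + π ^ 2) * δ₁ + ((xc δ₁ + π ^ 2) ^ 3 + π ^ 2 * (xc δ₁ + π ^ 2) * δ₀) / xc δ₁ ≤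
      (x + π ^ 2) * δ₁ + ((x + π ^ 2) ^ 3 + π ^ 2 * (x + π ^ 2) * δ₀) / x) :
    Tendsto (fun δ₁ : ℝ => δ₁ * (xc δ₁) ^ 2) atTop (nhds (π ^ 4 * (π ^ 2 + δ₀))) := by
  have key : ∀ d : ℝ, 0 < d → d * xc d ^ 2 =
      π ^ 4 * (π ^ 2 + δ₀) - 2 * xc d ^ 3 - 3 * π ^ 2 * xc d ^ 2 := by
    intro d hd
    obtain ⟨hp, hm⟩ := hxc d hd
    have hne : xc d ≠ 0 := hp.ne'
    have hloc : IsLocalMin (fun x : ℝ => (x + π ^ 2) * d +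
        ((x + π ^ 2) ^ 3 + π ^ 2 * (x + π ^ 2) * δ₀) / x) (xc d) := by
      filter_upwards [lt_mem_nhds hp] with x hx using hm x hx
    have h1 : HasDerivAt (fun x : ℝ => x + π ^ 2) 1 (xc d) :=
      (hasDerivAt_id (xc d)).add_const _
    have hder := (h1.mul_const d).add
      ((((h1.pow 3).add ((h1.const_mul (π ^ 2)).mul_const δ₀))).div (hasDerivAt_id (xc d)) hne)
    have h0 := hloc.hasDerivAt_eq_zero hder
    simp at h0
    field_simp at h0
    linarith
  have hK : 0 ≤ π ^ 4 * (π ^ 2 + δ₀) := by positivity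
  have hsq : Tendsto (fun d : ℝ => xc d ^ 2) atTop (nhds 0) := by
    have hlim : Tendsto (fun d : ℝ => π ^ 4 * (π ^ 2 + δ₀) / d) atTop (nhds 0) :=
      tendsto_const_nhds.div_atTop tendsto_id
    refine tendsto_of_tendsto_of_tendsto_of_le_of_le' tendsto_const_nhds hlim ?_ ?_
    · exact Eventually.of_forall fun d => sq_nonneg _
    · filter_upwards [eventually_gt_atTop 0] with d hd
      have hp := (hxc d hd).1
      have h3 : 0 < xc d ^ 3 := by positivity
      have h2 : 0 ≤ 3 * π ^ 2 * xc d ^ 2 := by positivity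
      rw [le_div_iff₀ hd]
      linarith [key d hd]
  have hx : Tendsto xc atTop (nhds 0) := by
    have h := (Real.continuous_sqrt.tendsto 0).comp hsq
    rw [Real.sqrt_zero] at h
    refine h.congr' ?_
    filter_upwards [eventually_gt_atTop 0] with d hd
    exact Real.sqrt_sq (hxc d hd).1.le
  have hfin : Tendsto (fun d : ℝ => π ^ 4 * (π ^ 2 + δ₀) - 2 * xc d ^ 3 - 3 * π ^ 2 * xc d ^ 2)
      atTop (nhds (π ^ 4 * (π ^ 2 + δ₀) - 2 * 0 ^ 3 - 3 * π ^ 2 * 0)) :=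
    (tendsto_const_nhds.sub ((hx.pow 3).const_mul 2)).sub (hsq.const_mul _)
  have e : π ^ 4 * (π ^ 2 + δ₀) - 2 * 0 ^ 3 - 3 * π ^ 2 * 0 = π ^ 4 * (π ^ 2 + δ₀) := by ring
  rw [e] at hfin
  refine hfin.congr' ?_
  filter_upwards [eventually_gt_atTop 0] with d hd
  exact (key d hd).symm
end

section
/- Fix δ₀ ≥ 0. For each δ₁ > 0 let g_{δ₁}(x) = (x + π²)δ₁ + ((x + π²)³ + π²(x + π²)δ₀)/x for x > 0, and let x_c : (0, ∞) → (0, ∞) be any function such that for every δ₁ > 0, x_c(δ₁) is a minimizer of g_{δ₁} on (0, ∞). Then the nondimensional convective scale L_c(δ₁)² := π²/x_c(δ₁) satisfies L_c(δ₁)² · √((π² + δ₀)/δ₁) → 1 as δ₁ → +∞. -/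
open Real Filter

/-- Large-friction asymptotics of the convective scale (equation (10.29)):
if for every `δ₁ > 0`, `x_c(δ₁) > 0` minimizes
`g_{δ₁}(x) = (x + π²)δ₁ + ((x + π²)³ + π²(x + π²)δ₀)/x` over `(0, ∞)`, then the
nondimensional convective scale `L_c(δ₁)² = π²/x_c(δ₁)` satisfies
`L_c(δ₁)² · √((π² + δ₀)/δ₁) → 1` as `δ₁ → +∞`. -/
theorem convective_scale_asymptotics (δ₀ : ℝ) (h₀ : 0 ≤ δ₀) (xc : ℝ → ℝ)
    (hxc : ∀ δ₁ : ℝ, 0 < δ₁ → 0 < xc δ₁ ∧ ∀ x : ℝ, 0 < x →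
      (xc δ₁ + π ^ 2) * δ₁ + ((xc δ₁ + π ^ 2) ^ 3 + π ^ 2 * (xc δ₁ + π ^ 2) * δ₀) / xc δ₁ ≤
      (x + π ^ 2) * δ₁ + ((x + π ^ 2) ^ 3 + π ^ 2 * (x + π ^ 2) * δ₀) / x) :
    Tendsto (fun δ₁ : ℝ => (π ^ 2 / xc δ₁) * Real.sqrt ((π ^ 2 + δ₀) / δ₁))
      atTop (nhds 1) := by
  have hp : 0 < π ^ 2 := by positivity
  generalize π ^ 2 = p at *
  have key : ∀ d : ℝ, 0 < d → xc d ^ 2 * (d + 2 * xc d + 3 * p) = p ^ 2 * (p + δ₀) := by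
    intro d hd
    obtain ⟨hx, hmin⟩ := hxc d hd
    have hloc : IsLocalMin (fun x : ℝ => (x + p) * d + ((x + p) ^ 3 + p * (x + p) * δ₀) / x)
        (xc d) := by
      filter_upwards [lt_mem_nhds hx] with x hx'
      exact hmin x hx'
    have hid := hasDerivAt_id' (xc d)
    have h1 := hid.add_const p
    have hder := (h1.mul_const d).add
      (((h1.pow 3).add ((h1.const_mul p).mul_const δ₀)).div hid hx.ne')
    have h0 := hloc.hasDerivAt_eq_zero hder
    simp only [Pi.add_apply, Pi.pow_apply] at h0
    field_simp at h0
    norm_num at h0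
    linear_combination h0
  have hbd : ∀ d : ℝ, 1 ≤ d → xc d ≤ p ^ 2 * (p + δ₀) + 1 := by
    intro d hd
    have hx := (hxc d (by linarith)).1
    have hk := key d (by linarith)
    have h2 : xc d ^ 2 * 1 ≤ xc d ^ 2 * (d + 2 * xc d + 3 * p) :=
      mul_le_mul_of_nonneg_left (by linarith) (by positivity)
    nlinarith [sq_nonneg (xc d - 1)]
  have hlim : Tendsto (fun d : ℝ => 1 + (2 * xc d + 3 * p) / d) atTop (nhds 1) := by
    have hz : Tendsto (fun d : ℝ => (2 * xc d + 3 * p) / d) atTop (nhds 0) := by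
      refine squeeze_zero' (g := fun d : ℝ => (2 * (p ^ 2 * (p + δ₀) + 1) + 3 * p) / d) ?_ ?_
        (tendsto_const_nhds.div_atTop tendsto_id)
      · filter_upwards [eventually_ge_atTop 1] with d hd
        have hx := (hxc d (by linarith)).1
        positivity
      · filter_upwards [eventually_ge_atTop 1] with d hd
        have := hbd d hd
        have hd0 : 0 < d := by linarith
        gcongr
    simpa using hz.const_add 1
  have hs := hlim.sqrt
  rw [Real.sqrt_one] at hs
  refine hs.congr' ?_
  filter_upwards [eventually_ge_atTop 1] with d hd
  have hd0 : 0 < d := by linarith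
  have hx := (hxc d hd0).1
  have hk := key d hd0
  rw [Real.sqrt_eq_iff_mul_self_eq (by positivity) (by positivity)]
  have hsq : Real.sqrt ((p + δ₀) / d) ^ 2 = (p + δ₀) / d := Real.sq_sqrt (by positivity)
  symm
  calc _ = (p / xc d) ^ 2 * Real.sqrt ((p + δ₀) / d) ^ 2 := by ring
    _ = _ := by
      rw [hsq]
      field_simp
      linear_combination -hk
end

section
/- Fix δ₀ ≥ 0. For each δ₁ > 0 let g_{δ₁}(x) = (x + π²)δ₁ + ((x + π²)³ + π²(x + π²)δ₀)/x for x > 0, and let R_c(δ₁) = inf over x > 0 of g_{δ₁}(x) be the critical Rayleigh number. Then R_c(δ₁)/(π²δ₁) → 1 as δ₁ → +∞. -/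
open Real Filter Set

/-- Leading-order large-friction asymptotics of the critical Rayleigh number
(equation (10.30)): with
`R_c(δ₁) = inf_{x > 0} [(x + π²)δ₁ + ((x + π²)³ + π²(x + π²)δ₀)/x]`,
one has `R_c(δ₁)/(π²δ₁) → 1` as `δ₁ → +∞`. -/
theorem critical_rayleigh_asymptotics (δ₀ : ℝ) (h₀ : 0 ≤ δ₀) :
    Tendsto (fun δ₁ : ℝ =>
      sInf ((fun x : ℝ =>
        (x + π ^ 2) * δ₁ + ((x + π ^ 2) ^ 3 + π ^ 2 * (x + π ^ 2) * δ₀) / x) '' Ioi 0)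
        / (π ^ 2 * δ₁)) atTop (nhds 1) := by
  have hp : 0 < π ^ 2 := by positivity
  have hlow : ∀ δ₁ : ℝ, 0 < δ₁ → ∀ y ∈ ((fun x : ℝ =>
        (x + π ^ 2) * δ₁ + ((x + π ^ 2) ^ 3 + π ^ 2 * (x + π ^ 2) * δ₀) / x) '' Ioi 0),
        π ^ 2 * δ₁ ≤ y := by
    rintro δ₁ h _ ⟨x, hx, rfl⟩
    have hx : 0 < x := hx
    have h1 : 0 ≤ ((x + π ^ 2) ^ 3 + π ^ 2 * (x + π ^ 2) * δ₀) / x := by positivity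
    have h2 : 0 < x * δ₁ := by positivity
    show π ^ 2 * δ₁ ≤ (x + π ^ 2) * δ₁ + ((x + π ^ 2) ^ 3 + π ^ 2 * (x + π ^ 2) * δ₀) / x
    linarith
  rw [tendsto_order]
  constructor
  · intro a ha
    filter_upwards [eventually_gt_atTop 0] with δ₁ h
    refine ha.trans_le ?_
    rw [le_div_iff₀ (by positivity), one_mul]
    exact le_csInf ((nonempty_Ioi).image _) (hlow δ₁ h)
  · intro b hb
    obtain ⟨x, hxdef⟩ : ∃ x : ℝ, x = π ^ 2 * ((b - 1) / 2) := ⟨_, rfl⟩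
    have hx : 0 < x := by
      rw [hxdef]; exact mul_pos hp (by linarith)
    obtain ⟨C, hC⟩ : ∃ C : ℝ, C = ((x + π ^ 2) ^ 3 + π ^ 2 * (x + π ^ 2) * δ₀) / x := ⟨_, rfl⟩
    filter_upwards [eventually_gt_atTop 0, eventually_gt_atTop (C / x)] with δ₁ h h'
    rw [div_lt_iff₀ (by positivity)]
    have h1 : C < δ₁ * x := (div_lt_iff₀ hx).1 h'
    refine (csInf_le ⟨_, hlow δ₁ h⟩ (mem_image_of_mem _ (mem_Ioi.2 hx))).trans_lt ?_
    show (x + π ^ 2) * δ₁ + ((x + π ^ 2) ^ 3 + π ^ 2 * (x + π ^ 2) * δ₀) / x < _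
    rw [← hC]
    have h2 : b * (π ^ 2 * δ₁) = (x + π ^ 2) * δ₁ + δ₁ * x := by rw [hxdef]; ring
    linarith
end
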